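/- Equip ℝ² with the componentwise (coordinatewise) lattice order and the product (x, y)·(x′, y′) = (xx′ + xy′ + yx′, yy′). Then ℝ² with these structures is an Archimedean lattice-ordered algebra with multiplicative identity (0, 1), but it is not an f-algebra: for instance, (0,1) ∧ (1,0) = (0,0) and (1,0) ≥ (0,0), yet ((1,0)·(0,1)) ∧ (1,0) = (1,0) ≠ (0,0). Consequently, there is no lattice-algebra homomorphism Ψ : PG_1 → ℝ² with Ψ(𝟙) = (0, 1) and Ψ(π₁) = (1, 0). -/

import Mathlib

open scoped BigOperators

/-- A continuous function `ℝⁿ → ℝ` of polynomial growth (an element of `PG_n`). -/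
def PolyGrowth (n : ℕ) (f : (Fin n → ℝ) → ℝ) : Prop :=
  Continuous f ∧ ∃ (M : ℝ) (N : ℕ), 0 ≤ M ∧
    ∀ t : Fin n → ℝ, |f t| ≤ M * (1 + ∑ i : Fin n, |t i|) ^ N

/-- An element of `PG_n^h`: a polynomial growth continuous function `f` such that
`f (t • x) / t` converges as `t → 0⁺`, uniformly in `x` on every bounded set. -/
def PolyGrowthH (n : ℕ) (f : (Fin n → ℝ) → ℝ) : Prop :=
  PolyGrowth n f ∧ ∃ fh : (Fin n → ℝ) → ℝ,
    ∀ B : Set (Fin n → ℝ), Bornology.IsBounded B →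
      ∀ ε : ℝ, 0 < ε → ∃ δ : ℝ, 0 < δ ∧
        ∀ t : ℝ, 0 < t → t < δ → ∀ y ∈ B, |f (t • y) / t - fh y| < ε

/-- An element of `H_n`: a continuous positively homogeneous function `ℝⁿ → ℝ`. -/
def PosHomog (n : ℕ) (f : (Fin n → ℝ) → ℝ) : Prop :=
  Continuous f ∧ ∀ (c : ℝ), 0 ≤ c → ∀ t : Fin n → ℝ, f (c • t) = c * f t

section Defs

variable {X : Type*} [Lattice X] [AddCommGroup X] [Module ℝ X]

/-- The order ideal `I_e` generated by `e`. -/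
def idealSet (e : X) : Set X := {x : X | ∃ c : ℝ, 0 ≤ c ∧ |x| ≤ c • e}

/-- The norm `‖x‖_e = inf {c ≥ 0 : |x| ≤ c • e}`. -/
noncomputable def regNorm (e x : X) : ℝ := sInf {c : ℝ | 0 ≤ c ∧ |x| ≤ c • e}

/-- The norm `‖·‖_e` is complete on the set `S`: every `‖·‖_e`-Cauchy sequence in `S`
converges, in `‖·‖_e`, to an element of `S`. -/
def NormComplete (e : X) (S : Set X) : Prop :=
  ∀ u : ℕ → X, (∀ k, u k ∈ S) →
    (∀ ε : ℝ, 0 < ε → ∃ N : ℕ, ∀ p q : ℕ, N ≤ p → N ≤ q → regNorm e (u p - u q) < ε) →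
    ∃ x ∈ S, ∀ ε : ℝ, 0 < ε → ∃ N : ℕ, ∀ p : ℕ, N ≤ p → regNorm e (u p - x) < ε

/-- A uniformly complete vector lattice: `(I_e, ‖·‖_e)` is complete for every `e ≥ 0`. -/
def UniformlyComplete (X : Type*) [Lattice X] [AddCommGroup X] [Module ℝ X] : Prop :=
  ∀ e : X, 0 ≤ e → NormComplete e (idealSet e)

/-- A subset `Z` is uniformly complete as a vector lattice in its own right. -/
def UCSet (Z : Set X) : Prop :=
  ∀ e ∈ Z, 0 ≤ e → NormComplete e (Z ∩ idealSet e)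

/-- A (vector) sublattice: a linear subspace closed under binary suprema. -/
def IsSublatticeSet (Z : Set X) : Prop :=
  (0 ∈ Z) ∧ (∀ a ∈ Z, ∀ b ∈ Z, a + b ∈ Z) ∧ (∀ (c : ℝ), ∀ a ∈ Z, c • a ∈ Z) ∧
  (∀ a ∈ Z, -a ∈ Z) ∧ (∀ a ∈ Z, ∀ b ∈ Z, a ⊔ b ∈ Z) ∧ (∀ a ∈ Z, ∀ b ∈ Z, a ⊓ b ∈ Z)

/-- An order ideal: a linear subspace that is solid. -/
def IsOrderIdealSet (I : Set X) : Prop :=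
  (0 ∈ I) ∧ (∀ a ∈ I, ∀ b ∈ I, a + b ∈ I) ∧ (∀ (c : ℝ), ∀ a ∈ I, c • a ∈ I) ∧
  (∀ a ∈ I, ∀ b : X, |b| ≤ |a| → b ∈ I)

/-- A vector lattice homomorphism defined on the class of functions `ℝⁿ → ℝ`
satisfying the predicate `P` (with pointwise operations), taking values in `X`. -/
def IsLatHom {n : ℕ} (P : ((Fin n → ℝ) → ℝ) → Prop) (Φ : ∀ f, P f → X) : Prop :=
  (∀ (f g : (Fin n → ℝ) → ℝ) (hf : P f) (hg : P g) (hfg : P (f + g)),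
      Φ (f + g) hfg = Φ f hf + Φ g hg) ∧
  (∀ (c : ℝ) (f : (Fin n → ℝ) → ℝ) (hf : P f) (hcf : P (c • f)),
      Φ (c • f) hcf = c • Φ f hf) ∧
  (∀ (f g : (Fin n → ℝ) → ℝ) (hf : P f) (hg : P g) (hfg : P (f ⊔ g)),
      Φ (f ⊔ g) hfg = Φ f hf ⊔ Φ g hg)

end Defs

section MulDefs

variable {X : Type*} [Lattice X] [AddCommGroup X] [Module ℝ X] [Mul X]

/-- A lattice-algebra homomorphism defined on the class of functions `ℝⁿ → ℝ`
satisfying the predicate `P` (with pointwise operations), taking values in `X`. -/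
def IsLatAlgHom {n : ℕ} (P : ((Fin n → ℝ) → ℝ) → Prop) (Ψ : ∀ f, P f → X) : Prop :=
  IsLatHom P Ψ ∧
  (∀ (f g : (Fin n → ℝ) → ℝ) (hf : P f) (hg : P g) (hfg : P (f * g)),
      Ψ (f * g) hfg = Ψ f hf * Ψ g hg)

/-- A sublattice-algebra: a linear subspace that is both a sublattice and a subalgebra. -/
def IsSublatticeAlgebraSet (Z : Set X) : Prop :=
  IsSublatticeSet Z ∧ ∀ a ∈ Z, ∀ b ∈ Z, a * b ∈ Z

/-- The `f`-algebra condition, relativized to a subset. -/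
def IsFAlgebraSet (Z : Set X) : Prop :=
  ∀ a ∈ Z, ∀ b ∈ Z, ∀ z ∈ Z, a ⊓ b = 0 → 0 ≤ z → (z * a) ⊓ b = 0 ∧ (a * z) ⊓ b = 0

/-- An `f`-subalgebra: a sublattice-algebra which is itself an `f`-algebra. -/
def IsFSubalgebra (Z : Set X) : Prop := IsSublatticeAlgebraSet Z ∧ IsFAlgebraSet Z

/-- `powS e m = e^(m+1)`, defined without assuming an identity element. -/
def powS (e : X) : ℕ → X
  | 0 => e
  | m + 1 => powS e m * e

end MulDefs

/-- A map `T : X → A` which is a lattice-algebra homomorphism on a subset `S` of `X`. -/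
def IsLatAlgHomOn {X A : Type*} [Lattice X] [AddCommGroup X] [Module ℝ X] [Mul X]
    [Lattice A] [AddCommGroup A] [Module ℝ A] [Mul A] (S : Set X) (T : X → A) : Prop :=
  (∀ a ∈ S, ∀ b ∈ S, T (a + b) = T a + T b) ∧
  (∀ (c : ℝ), ∀ a ∈ S, T (c • a) = c • T a) ∧
  (∀ a ∈ S, ∀ b ∈ S, T (a ⊔ b) = T a ⊔ T b) ∧
  (∀ a ∈ S, ∀ b ∈ S, T (a * b) = T a * T b)

theorem PolyGrowth.one (n : ℕ) : PolyGrowth n 1 :=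
  ⟨continuous_const, 1, 0, zero_le_one, fun t => by simp⟩

theorem PolyGrowth.proj {n : ℕ} (i : Fin n) : PolyGrowth n fun t => t i := by
  refine ⟨continuous_apply i, 1, 1, zero_le_one, fun t => ?_⟩
  have h := Finset.single_le_sum (f := fun j => |t j|) (fun j _ => abs_nonneg (t j))
    (Finset.mem_univ i)
  linarith

theorem PolyGrowth.mul {n : ℕ} {f g : (Fin n → ℝ) → ℝ} (hf : PolyGrowth n f)
    (hg : PolyGrowth n g) : PolyGrowth n (f * g) := by
  obtain ⟨hfc, M, N, hM, hfb⟩ := hf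
  obtain ⟨hgc, M', N', hM', hgb⟩ := hg
  refine ⟨hfc.mul hgc, M * M', N + N', mul_nonneg hM hM', fun t => ?_⟩
  calc |(f * g) t| = |f t| * |g t| := abs_mul _ _
    _ ≤ (M * (1 + ∑ i, |t i|) ^ N) * (M' * (1 + ∑ i, |t i|) ^ N') :=
      mul_le_mul (hfb t) (hgb t) (abs_nonneg _) ((abs_nonneg _).trans (hfb t))
    _ = M * M' * (1 + ∑ i, |t i|) ^ (N + N') := by ring

theorem PolyGrowth.smul {n : ℕ} (c : ℝ) {f : (Fin n → ℝ) → ℝ} (hf : PolyGrowth n f) :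
    PolyGrowth n (c • f) := by
  obtain ⟨hfc, M, N, hM, hfb⟩ := hf
  refine ⟨hfc.const_smul c, |c| * M, N, by positivity, fun t => ?_⟩
  rw [Pi.smul_apply, smul_eq_mul, abs_mul, mul_assoc]
  exact mul_le_mul_of_nonneg_left (hfb t) (abs_nonneg c)

theorem PolyGrowth.add {n : ℕ} {f g : (Fin n → ℝ) → ℝ} (hf : PolyGrowth n f)
    (hg : PolyGrowth n g) : PolyGrowth n (f + g) := by
  obtain ⟨hfc, M, N, hM, hfb⟩ := hf
  obtain ⟨hgc, M', N', hM', hgb⟩ := hg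
  refine ⟨hfc.add hgc, M + M', max N N', add_nonneg hM hM', fun t => ?_⟩
  have hs : 1 ≤ 1 + ∑ i, |t i| :=
    le_add_of_nonneg_right (Finset.sum_nonneg fun i _ => abs_nonneg (t i))
  calc |(f + g) t| ≤ |f t| + |g t| := abs_add_le _ _
    _ ≤ M * (1 + ∑ i, |t i|) ^ max N N' + M' * (1 + ∑ i, |t i|) ^ max N N' := by
      refine add_le_add ((hfb t).trans ?_) ((hgb t).trans ?_)
      · exact mul_le_mul_of_nonneg_left (pow_le_pow_right₀ hs (le_max_left _ _)) hM
      · exact mul_le_mul_of_nonneg_left (pow_le_pow_right₀ hs (le_max_right _ _)) hM'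
    _ = (M + M') * (1 + ∑ i, |t i|) ^ max N N' := by ring

theorem IsLatHom.mono {X : Type*} [Lattice X] [AddCommGroup X] [Module ℝ X] {n : ℕ}
    {P : ((Fin n → ℝ) → ℝ) → Prop} {Φ : ∀ f, P f → X} (hΦ : IsLatHom P Φ)
    {f g : (Fin n → ℝ) → ℝ} (hf : P f) (hg : P g) (hfg : f ≤ g) : Φ f hf ≤ Φ g hg := by
  have key : ∀ (k : (Fin n → ℝ) → ℝ) (hk : P k), k = g → Φ k hk = Φ g hg := by
    rintro k hk rfl
    rfl
  have hsup : f ⊔ g = g := sup_eq_right.2 hfg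
  have h := hΦ.2.2 f g hf hg (hsup.symm ▸ hg)
  rw [key _ _ hsup] at h
  exact sup_eq_right.1 h.symm

/-- Example 3.7: `ℝ²` with the componentwise order and the product
`(x,y)·(x′,y′) = (xx′ + xy′ + yx′, yy′)` is an Archimedean lattice-ordered algebra with
identity `(0,1)` which is not an `f`-algebra, and which therefore admits no polynomial
growth continuous function calculus at the element `(1,0)`. -/
theorem stmt_17 :
    let mul : ℝ × ℝ → ℝ × ℝ → ℝ × ℝ :=
      fun p q => (p.1 * q.1 + p.1 * q.2 + p.2 * q.1, p.2 * q.2)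
    -- associativity and bilinearity
    (∀ p q r : ℝ × ℝ, mul (mul p q) r = mul p (mul q r)) ∧
    (∀ p q r : ℝ × ℝ, mul (p + q) r = mul p r + mul q r) ∧
    (∀ p q r : ℝ × ℝ, mul p (q + r) = mul p q + mul p r) ∧
    (∀ (c : ℝ) (p q : ℝ × ℝ), mul (c • p) q = c • mul p q ∧ mul p (c • q) = c • mul p q) ∧
    -- products of positive elements are positive
    (∀ p q : ℝ × ℝ, 0 ≤ p → 0 ≤ q → 0 ≤ mul p q) ∧
    -- the order is Archimedean
    (∀ p q : ℝ × ℝ, 0 ≤ p → 0 ≤ q → (∀ k : ℕ, k • p ≤ q) → p = 0) ∧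
    -- `(0, 1)` is a multiplicative identity
    (∀ p : ℝ × ℝ, mul p (0, 1) = p ∧ mul (0, 1) p = p) ∧
    -- failure of the `f`-algebra property
    ((((0 : ℝ), (1 : ℝ)) ⊓ ((1 : ℝ), (0 : ℝ)) = 0 ∧
      (0 : ℝ × ℝ) ≤ ((1 : ℝ), (0 : ℝ)) ∧
      mul ((1 : ℝ), (0 : ℝ)) ((0 : ℝ), (1 : ℝ)) ⊓ ((1 : ℝ), (0 : ℝ))
        = ((1 : ℝ), (0 : ℝ)) ∧
      (((1 : ℝ), (0 : ℝ)) : ℝ × ℝ) ≠ 0)) ∧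
    -- hence no polynomial growth continuous function calculus at `(1, 0)`
    ¬ ∃ Ψ : ∀ f : (Fin 1 → ℝ) → ℝ, PolyGrowth 1 f → ℝ × ℝ,
        IsLatHom (PolyGrowth 1) Ψ ∧
        (∀ (f g : (Fin 1 → ℝ) → ℝ) (hf : PolyGrowth 1 f) (hg : PolyGrowth 1 g)
          (hfg : PolyGrowth 1 (f * g)), Ψ (f * g) hfg = mul (Ψ f hf) (Ψ g hg)) ∧
        (∀ h1 : PolyGrowth 1 1, Ψ 1 h1 = ((0 : ℝ), (1 : ℝ))) ∧
        (∀ h : PolyGrowth 1 fun t => t 0, Ψ (fun t => t 0) h = ((1 : ℝ), (0 : ℝ))) := by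
  intro mul
  refine ⟨?_, ?_, ?_, ?_, ?_, ?_, ?_, ⟨?_, ?_, ?_, ?_⟩, ?_⟩
  · intro p q r
    ext <;> simp only [mul] <;> ring
  · intro p q r
    ext <;> simp only [mul, Prod.fst_add, Prod.snd_add] <;> ring
  · intro p q r
    ext <;> simp only [mul, Prod.fst_add, Prod.snd_add] <;> ring
  · intro c p q
    constructor <;> ext <;>
      simp only [mul, Prod.smul_fst, Prod.smul_snd, smul_eq_mul] <;> ring
  · rintro ⟨a, b⟩ ⟨c, d⟩ ⟨ha, hb⟩ ⟨hc, hd⟩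
    simp only [Prod.fst_zero, Prod.snd_zero] at ha hb hc hd
    constructor <;> simp only [mul, Prod.fst_zero, Prod.snd_zero] <;> positivity
  · have archimedean : ∀ a b : ℝ, 0 ≤ a → (∀ k : ℕ, k • a ≤ b) → a = 0 := by
      intro a b ha h
      by_contra hne
      obtain ⟨k, hk⟩ := exists_lt_nsmul (lt_of_le_of_ne ha (Ne.symm hne)) b
      exact absurd (h k) (not_le.2 hk)
    intro p q hp _ h
    exact Prod.ext (archimedean _ _ hp.1 fun k => (h k).1)
      (archimedean _ _ hp.2 fun k => (h k).2)
  · intro p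
    constructor <;> ext <;> simp [mul]
  · ext <;> simp
  · constructor <;> simp
  · ext <;> simp [mul]
  · simp
  · rintro ⟨Ψ, hlat, hmul, hone, hproj⟩
    have h1 := PolyGrowth.one 1
    have hπ : PolyGrowth 1 fun t => t 0 := PolyGrowth.proj 0
    have hsq := hπ.mul hπ
    have hle : (fun t : Fin 1 → ℝ => t 0) ≤
        (1 / 4 : ℝ) • ((fun t : Fin 1 → ℝ => t 0) * fun t => t 0) + 1 := by
      intro t
      simp only [Pi.add_apply, Pi.smul_apply, Pi.mul_apply, Pi.one_apply, smul_eq_mul]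
      nlinarith [sq_nonneg (t 0 - 2)]
    have h := (hlat.mono hπ ((hsq.smul (1 / 4)).add h1) hle).1
    rw [hlat.1 _ _ (hsq.smul (1 / 4)) h1, hlat.2.1 _ _ hsq, hmul _ _ hπ hπ, hone, hproj] at h
    norm_num [mul] at h
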